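/- Let G = (V,E) be a simple connected undirected graph with |V| = n. If a bijection φ : V → {1,…,n} minimizes the α-measure α_A(G,·) over all bijections from V to {1,…,n} (i.e., (G,φ) is an α-optimal linear arrangement), then φ also minimizes the α-measure α_L(G,·) over all bijections (i.e., the linear reassembling of G induced by φ is α-optimal among all linear reassemblings of G). -/

import Mathlib

open Finset

/-- The edge-boundary degree of a vertex set `A` in a simple graph `G`: the number of
edges of `G` with exactly one endpoint in `A`. -/
def cutDeg {α : Type*} [Fintype α] [DecidableEq α] (G : SimpleGraph α) [DecidableRel G.Adj]
    (A : Finset α) : ℕ :=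
  (univ.filter (fun e : α × α => e.1 ∈ A ∧ e.2 ∉ A ∧ G.Adj e.1 e.2)).card

/-- `L(φ, j)`: the set of vertices occupying the first `j` positions of the linear
arrangement `φ`. -/
def prefixSet {α : Type*} [Fintype α] {N : ℕ} (φ : α ≃ Fin N) (j : ℕ) : Finset α :=
  univ.filter (fun v => (φ v : ℕ) < j)

/-- The α-measure of the linear arrangement `φ`: `max_{1 ≤ i ≤ N} deg(L(φ,i))`. -/
def alphaA {α : Type*} [Fintype α] [DecidableEq α] (G : SimpleGraph α) [DecidableRel G.Adj]
    {N : ℕ} (φ : α ≃ Fin N) : ℕ :=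
  (Finset.Icc 1 N).sup (fun i => cutDeg G (prefixSet φ i))

/-- The α-measure of the linear reassembling determined by `φ`: the maximum of all vertex
degrees (the singleton clusters) and of `deg(L(φ,j))` for `2 ≤ j ≤ N` (the non-singleton
clusters). -/
def alphaL {α : Type*} [Fintype α] [DecidableEq α] (G : SimpleGraph α) [DecidableRel G.Adj]
    {N : ℕ} (φ : α ≃ Fin N) : ℕ :=
  max (univ.sup (fun v => G.degree v))
    ((Finset.Icc 2 N).sup (fun j => cutDeg G (prefixSet φ j)))

theorem cutDeg_singleton_le_degree {α : Type*} [Fintype α] [DecidableEq α]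
    (G : SimpleGraph α) [DecidableRel G.Adj] (v : α) : cutDeg G {v} ≤ G.degree v := by
  rw [← G.card_neighborFinset_eq_degree]
  refine Finset.card_le_card_of_injOn Prod.snd ?_ ?_
  · intro e he
    obtain ⟨h₁, -, h⟩ : e.1 = v ∧ e.2 ≠ v ∧ G.Adj e.1 e.2 := by simpa using he
    simpa [h₁] using h
  · intro e he f hf hef
    have he₁ : e.1 = v ∧ e.2 ≠ v ∧ G.Adj e.1 e.2 := by simpa using he
    have hf₁ : f.1 = v ∧ f.2 ≠ v ∧ G.Adj f.1 f.2 := by simpa using hf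
    exact Prod.ext (he₁.1.trans hf₁.1.symm) hef

theorem prefixSet_one {α : Type*} [Fintype α] {N : ℕ} (φ : α ≃ Fin N) (hN : 0 < N) :
    prefixSet φ 1 = {φ.symm ⟨0, hN⟩} := by
  ext v
  simp [prefixSet, Equiv.eq_symm_apply, Fin.ext_iff]

theorem alphaA_le_alphaL {α : Type*} [Fintype α] [DecidableEq α] (G : SimpleGraph α)
    [DecidableRel G.Adj] {N : ℕ} (φ : α ≃ Fin N) : alphaA G φ ≤ alphaL G φ := by
  refine Finset.sup_le fun i hi => ?_
  rw [Finset.mem_Icc] at hi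
  rcases hi.1.eq_or_lt with rfl | h
  · rw [prefixSet_one φ hi.2]
    exact (cutDeg_singleton_le_degree G _).trans
      ((Finset.le_sup (f := fun v => G.degree v) (mem_univ _)).trans (le_max_left _ _))
  · exact (Finset.le_sup (f := fun j => cutDeg G (prefixSet φ j))
      (Finset.mem_Icc.2 ⟨h, hi.2⟩)).trans (le_max_right _ _)

/-- If a linear arrangement `φ` of a simple connected graph `G` minimizes the α-measure
`α_A` over all linear arrangements (it is an α-optimal linear arrangement), then `φ` also
minimizes `α_L`, i.e. the linear reassembling induced by `φ` is α-optimal among all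
linear reassemblings of `G`. -/
theorem stmt11 {α : Type*} [Fintype α] [DecidableEq α]
    (G : SimpleGraph α) [DecidableRel G.Adj]
    (hconn : G.Connected)
    (n : ℕ) (hn : Fintype.card α = n) (φ : α ≃ Fin n)
    (hopt : ∀ ψ : α ≃ Fin n, alphaA G φ ≤ alphaA G ψ) :
    ∀ ψ : α ≃ Fin n, alphaL G φ ≤ alphaL G ψ := by
  intro ψ
  refine max_le (le_max_left _ _) ?_
  calc (Finset.Icc 2 n).sup (fun j => cutDeg G (prefixSet φ j))
      ≤ alphaA G φ := Finset.sup_mono (Finset.Icc_subset_Icc_left one_le_two)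
    _ ≤ alphaA G ψ := hopt ψ
    _ ≤ alphaL G ψ := alphaA_le_alphaL G ψ
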